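/- arXiv:2102.03790 — 4 statements merged into one kernel-verified Lean document; each statement's English description precedes it below -/
import Mathlib

section
/- For a group G with its finitary coarse structure 𝓔, the following are equivalent: (i) there exists a linear order ≤ on G such that 𝓔 is interval with respect to ≤; (ii) there exists a linear order ≤ on G compatible with 𝓔; (iii) G admits a 2-selector. -/
open scoped Pointwise

/-- The finitary coarse structure of `G` is interval with respect to the linear order
`lo`: each basic ball `F'x` of a suitable refined base is an order interval around `x`. -/
def IntervalWrt (G : Type*) [Group G] (lo : LinearOrder G) : Prop :=
  ∀ F : Finset G, (1 : G) ∈ F → ∃ F' : Finset G,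
    (F : Set G) ⊆ (F' : Set G) ∧ (1 : G) ∈ F' ∧
    ∀ x : G, ∃ a b : G, lo.le a x ∧ lo.le x b ∧
      ((F' : Set G) * {x} : Set G) = {z : G | lo.le a z ∧ lo.le z b}

/-- The linear order `lo` is compatible with the finitary coarse structure of `G`. -/
def CompatibleWrt (G : Type*) [Group G] (lo : LinearOrder G) : Prop :=
  ∀ F : Finset G, (1 : G) ∈ F → ∃ F' : Finset G,
    (F : Set G) ⊆ (F' : Set G) ∧ (1 : G) ∈ F' ∧
    ∀ x y : G, x ≠ y → y ∉ ((F' : Set G) * {x} : Set G) →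
      (lo.lt x y → ∀ x' ∈ ((F : Set G) * {x} : Set G), lo.lt x' y) ∧
      (lo.lt y x → ∀ x' ∈ ((F : Set G) * {x} : Set G), lo.lt y x')

/-- A 2-selector of a group `G`: a macro-uniform (with respect to the finitary coarse
structure) choice of a point of each 2-element subset of `G`. -/
def IsTwoSelector (G : Type*) [Group G] (f : Finset G → G) : Prop :=
  (∀ A : Finset G, A.card = 2 → f A ∈ A) ∧
  ∀ F : Finset G, (1 : G) ∈ F → ∃ F' : Finset G, (1 : G) ∈ F' ∧
    ∀ A B : Finset G, A.card = 2 → B.card = 2 →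
      (A : Set G) ⊆ (F : Set G) * (B : Set G) → (B : Set G) ⊆ (F : Set G) * (A : Set G) →
      ∃ g ∈ F', f A = g * f B

namespace LOC

lemma mem_ball {G : Type*} [Group G] (F : Finset G) (x z : G) :
    z ∈ ((F : Set G) * {x} : Set G) ↔ z * x⁻¹ ∈ F := by
  constructor
  · rintro ⟨a, ha, b, hb, rfl⟩
    simp only [Set.mem_singleton_iff] at hb
    subst hb
    simpa using ha
  · intro h
    exact ⟨z * x⁻¹, h, x, rfl, by simp⟩

lemma interval_compat {G : Type*} [Group G] (lo : LinearOrder G) (h : IntervalWrt G lo) :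
    CompatibleWrt G lo := by
  intro F hF
  obtain ⟨F', h1, h2, h3⟩ := h F hF
  refine ⟨F', h1, h2, ?_⟩
  intro x y hxy hy
  obtain ⟨a, b, hax, hxb, hS⟩ := h3 x
  have hsub : ∀ x' ∈ ((F : Set G) * {x} : Set G), a ≤ x' ∧ x' ≤ b := by
    intro x' hx'
    have : x' ∈ ((F' : Set G) * {x} : Set G) := Set.mul_subset_mul_right h1 hx'
    rw [hS] at this
    exact this
  rw [hS] at hy
  have hy' : ¬ (a ≤ y ∧ y ≤ b) := hy
  constructor
  · intro hlt x' hx'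
    have h4 := hsub x' hx'
    have : b < y := by
      by_contra hc
      exact hy' ⟨le_trans hax (le_of_lt hlt), not_lt.mp hc⟩
    exact lt_of_le_of_lt h4.2 this
  · intro hlt x' hx'
    have h4 := hsub x' hx'
    have : y < a := by
      by_contra hc
      exact hy' ⟨not_lt.mp hc, le_trans (le_of_lt hlt) hxb⟩
    exact lt_of_lt_of_le this h4.1

lemma compat_selector {G : Type*} [Group G] (lo : LinearOrder G) (h : CompatibleWrt G lo) :
    ∃ f : Finset G → G, IsTwoSelector G f := by
  classical
  refine ⟨fun A => if hA : A.Nonempty then A.min' hA else 1, ?_, ?_⟩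
  · intro A hA
    have : A.Nonempty := Finset.card_pos.mp (by omega)
    simp only [this, dif_pos]
    exact A.min'_mem this
  · intro F hF
    obtain ⟨F', h1, h2, h3⟩ := h F hF
    have key : ∀ a a' b b' : G, a < a' → b < b' → b * a'⁻¹ ∈ F → a * b'⁻¹ ∈ F →
        a * a'⁻¹ ∈ F' ∨ b * b'⁻¹ ∈ F' := by
      intro a a' b b' haa hbb hba hab
      by_contra hc
      push Not at hc
      have e1 := (h3 a' a haa.ne' (by rw [mem_ball]; exact hc.1)).2 haa b
        (by rw [mem_ball]; exact hba)
      have e2 := (h3 b' b hbb.ne' (by rw [mem_ball]; exact hc.2)).2 hbb a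
        (by rw [mem_ball]; exact hab)
      exact lt_asymm e1 e2
    refine ⟨F ∪ F⁻¹ ∪ F' * F⁻¹ ∪ F * F'⁻¹, by simp [hF], ?_⟩
    intro A B hA hB hAB hBA
    have hAn : A.Nonempty := Finset.card_pos.mp (by omega)
    have hBn : B.Nonempty := Finset.card_pos.mp (by omega)
    simp only [hAn, hBn, dif_pos]
    have two : ∀ A : Finset G, A.card = 2 → ∃ a a', a < a' ∧ A = {a, a'} := by
      intro A hA
      obtain ⟨u, v, huv, rfl⟩ := Finset.card_eq_two.mp hA
      rcases lt_or_gt_of_ne huv with h | h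
      · exact ⟨u, v, h, rfl⟩
      · exact ⟨v, u, h, Finset.pair_comm _ _⟩
    obtain ⟨a, a', haa, rfl⟩ := two A hA
    obtain ⟨b, b', hbb, rfl⟩ := two B hB
    have m1 : ∀ hh, ({a, a'} : Finset G).min' hh = a := by
      intro hh
      apply le_antisymm
      · exact Finset.min'_le _ _ (by simp)
      · apply Finset.le_min'
        intro y hy
        simp at hy
        rcases hy with rfl | rfl
        · exact le_refl _
        · exact haa.le
    have m2 : ∀ hh, ({b, b'} : Finset G).min' hh = b := by
      intro hh
      apply le_antisymm
      · exact Finset.min'_le _ _ (by simp)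
      · apply Finset.le_min'
        intro y hy
        simp at hy
        rcases hy with rfl | rfl
        · exact le_refl _
        · exact hbb.le
    rw [m1, m2]
    refine ⟨a * b⁻¹, ?_, by simp⟩
    have q1 : a * b⁻¹ ∈ F ∨ a * b'⁻¹ ∈ F := by
      obtain ⟨u, hu, v, hv, huv⟩ := hAB (show a ∈ (({a, a'} : Finset G) : Set G) by simp)
      simp only [Finset.coe_insert, Finset.coe_singleton, Set.mem_insert_iff,
        Set.mem_singleton_iff] at hv
      simp only at huv
      rcases hv with rfl | rfl
      · left; rw [← huv]; simpa using hu
      · right; rw [← huv]; simpa using hu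
    have q2 : b * a⁻¹ ∈ F ∨ b * a'⁻¹ ∈ F := by
      obtain ⟨u, hu, v, hv, huv⟩ := hBA (show b ∈ (({b, b'} : Finset G) : Set G) by simp)
      simp only [Finset.coe_insert, Finset.coe_singleton, Set.mem_insert_iff,
        Set.mem_singleton_iff] at hv
      simp only at huv
      rcases hv with rfl | rfl
      · left; rw [← huv]; simpa using hu
      · right; rw [← huv]; simpa using hu
    simp only [Finset.mem_union]
    rcases q1 with q1 | q1
    · exact Or.inl (Or.inl (Or.inl q1))
    rcases q2 with q2 | q2
    · exact Or.inl (Or.inl (Or.inr (by rw [Finset.mem_inv']; simpa using q2)))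
    rcases key a a' b b' haa hbb q2 q1 with k | k
    · refine Or.inl (Or.inr ?_)
      rw [Finset.mem_mul]
      exact ⟨_, k, a' * b⁻¹, by rw [Finset.mem_inv']; simpa using q2, by group⟩
    · refine Or.inr ?_
      rw [Finset.mem_mul]
      exact ⟨_, q1, b' * b⁻¹, by rw [Finset.mem_inv']; simpa using k, by group⟩

/-- finite convex sets are intervals -/
lemma finite_convex {G : Type*} (lo : LinearOrder G) (S : Set G) (hS : S.Finite) (x : G)
    (hx : x ∈ S) (hc : ∀ u ∈ S, ∀ v ∈ S, ∀ z, u ≤ z → z ≤ v → z ∈ S) :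
    ∃ a b : G, lo.le a x ∧ lo.le x b ∧ S = {z : G | lo.le a z ∧ lo.le z b} := by
  obtain ⟨a, ha, ha'⟩ := Set.exists_min_image S id hS ⟨x, hx⟩
  obtain ⟨b, hb, hb'⟩ := Set.exists_max_image S id hS ⟨x, hx⟩
  refine ⟨a, b, ha' x hx, hb' x hx, ?_⟩
  ext z
  exact ⟨fun hz => ⟨ha' z hz, hb' z hz⟩, fun hz => hc a ha b hb z hz.1 hz.2⟩

/-- interval order from a coarse coordinate -/
lemma interval_of_coord {G : Type*} [Group G] (p : G → ℤ)
    (hp : ∀ z x, |p (z * x⁻¹)| = |p z - p x|) (hfin : ∀ n : ℤ, {g | |p g| ≤ n}.Finite) :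
    ∃ lo : LinearOrder G, IntervalWrt G lo := by
  classical
  let l0 : LinearOrder G := IsWellOrder.linearOrder WellOrderingRel
  let e : G → ℤ ×ₗ G := fun x => toLex (p x, x)
  have he : Function.Injective e := by
    intro x y h
    exact congrArg (fun w => (ofLex w).2) h
  have hlo : ∃ lo : LinearOrder G, ∀ x y, lo.le x y → p x ≤ p y := by
    refine ⟨LinearOrder.lift' e he, ?_⟩
    intro x y h
    have h' : e x ≤ e y := h
    rw [Prod.Lex.le_iff] at h'
    rcases h' with h' | h'
    · exact h'.le
    · exact h'.1.le
  clear e he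
  clear l0
  obtain ⟨lo, mono⟩ := hlo
  refine ⟨lo, ?_⟩
  intro F hF
  obtain ⟨n, hn⟩ : ∃ n : ℤ, ∀ g ∈ F, |p g| ≤ n := by
    obtain ⟨n, hn⟩ := (F.image fun g => |p g|).bddAbove
    exact ⟨n, fun g hg => hn (Finset.mem_coe.2 (Finset.mem_image_of_mem _ hg))⟩
  refine ⟨(hfin n).toFinset, ?_, ?_, ?_⟩
  · intro g hg
    simpa using hn g hg
  · simpa using hn 1 hF
  · intro x
    apply finite_convex lo
    · exact (Finset.finite_toSet _).mul (Set.finite_singleton x)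
    · rw [mem_ball]
      simpa using hn 1 hF
    · intro u hu v hv z hz1 hz2
      rw [mem_ball] at *
      simp only [Set.Finite.mem_toFinset, Set.mem_ofPred_eq, hp] at hu hv ⊢
      rw [abs_le] at *
      have := mono _ _ hz1
      have := mono _ _ hz2
      omega

/-- interval order for countable locally finite groups -/
lemma interval_of_locally_finite {G : Type*} [Group G] [Countable G]
    (hlf : ∀ F : Finset G, (Subgroup.closure (F : Set G) : Set G).Finite) :
    ∃ lo : LinearOrder G, IntervalWrt G lo := by
  classical
  obtain ⟨e, he⟩ := exists_injective_nat G
  let K : ℕ → Subgroup G := fun n => Subgroup.closure {g | e g < n}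
  have hKmono : Monotone K := by
    intro m n hmn
    apply Subgroup.closure_mono
    intro g hg
    exact lt_of_lt_of_le hg hmn
  have hKfin : ∀ n, (K n : Set G).Finite := by
    intro n
    have hf : {g | e g < n}.Finite := (Set.finite_lt_nat n).preimage he.injOn
    have := hlf hf.toFinset
    simpa using this
  have hKmem : ∀ g, g ∈ K (e g + 1) := fun g => Subgroup.subset_closure (by simp)
  have hK0 : K 0 = ⊥ := by simp [K]
  let c : ℕ → G → ℕ := fun n x => e (Quotient.out (Quotient.mk (QuotientGroup.rightRel (K n)) x))
  have hc : ∀ n x y, c n x = c n y ↔ y * x⁻¹ ∈ K n := by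
    intro n x y
    constructor
    · intro h
      have h1 := he h
      have h2 := Quotient.out_injective h1
      have h3 := Quotient.exact h2
      exact QuotientGroup.rightRel_apply.mp h3
    · intro h
      have : Quotient.mk (QuotientGroup.rightRel (K n)) x = Quotient.mk _ y :=
        Quotient.sound (QuotientGroup.rightRel_apply.mpr h)
      simp only [c, this]
  have hup : ∀ m n x y, m ≤ n → c m x = c m y → c n x = c n y := by
    intro m n x y hmn h
    rw [hc] at *
    exact hKmono hmn h
  let r : G → G → Prop := fun x y => ∃ n, c n x < c n y ∧ ∀ m, n < m → c m x = c m y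
  have tri : ∀ x y, x ≠ y → r x y ∨ r y x := by
    intro x y hxy
    have hex : ∃ n, c n x = c n y := ⟨_, (hc _ _ _).2 (hKmem (y * x⁻¹))⟩
    have h0 : Nat.find hex ≠ 0 := by
      intro h
      have := Nat.find_spec hex
      rw [h, hc, hK0, Subgroup.mem_bot, mul_inv_eq_one] at this
      exact hxy this.symm
    obtain ⟨k, hk⟩ := Nat.exists_eq_succ_of_ne_zero h0
    have hne : c k x ≠ c k y := Nat.find_min hex (by omega)
    have hgt : ∀ m, k < m → c m x = c m y := fun m hm =>
      hup _ m x y (by omega) (Nat.find_spec hex)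
    rcases lt_or_gt_of_ne hne with h | h
    · exact Or.inl ⟨k, h, hgt⟩
    · exact Or.inr ⟨k, h, fun m hm => (hgt m hm).symm⟩
  have irr : ∀ x, ¬ r x x := by
    rintro x ⟨n, hn, -⟩
    exact lt_irrefl _ hn
  have tr : ∀ x y z, r x y → r y z → r x z := by
    rintro x y z ⟨n, hn, hn'⟩ ⟨m, hm, hm'⟩
    rcases lt_trichotomy n m with h | h | h
    · exact ⟨m, by rw [hn' m h]; exact hm, fun k hk => (hn' k (by omega)).trans (hm' k hk)⟩
    · subst h
      exact ⟨n, hn.trans hm, fun k hk => (hn' k hk).trans (hm' k hk)⟩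
    · exact ⟨n, by rw [← hm' n h]; exact hn, fun k hk => (hn' k hk).trans (hm' k (by omega))⟩
  have : IsStrictTotalOrder G r :=
    { irrefl := irr, trans := tr,
      trichotomous := by
        intro a b h1 h2
        by_contra hne
        rcases tri a b hne with h | h
        · exact h1 h
        · exact h2 h }
  let lo : LinearOrder G := linearOrderOfSTO r
  have le_iff : ∀ x y, lo.le x y ↔ x = y ∨ r x y := fun x y => Iff.rfl
  refine ⟨lo, ?_⟩
  intro F hF
  obtain ⟨n, hn⟩ : ∃ n, ∀ g ∈ F, e g < n := by
    obtain ⟨n, hn⟩ := (F.image e).bddAbove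
    exact ⟨n + 1, fun g hg =>
      Nat.lt_succ_of_le (hn (Finset.mem_coe.2 (Finset.mem_image_of_mem _ hg)))⟩
  refine ⟨(hKfin n).toFinset, ?_, ?_, ?_⟩
  · intro g hg
    have : g ∈ K n := Subgroup.subset_closure (hn g hg)
    simpa using this
  · simpa using one_mem (K n)
  · intro x
    apply finite_convex lo
    · exact (Finset.finite_toSet _).mul (Set.finite_singleton x)
    · rw [mem_ball]
      simpa using one_mem (K n)
    · intro u hu v hv z hz1 hz2
      rw [mem_ball] at *
      simp only [Set.Finite.mem_toFinset, SetLike.mem_coe, ← hc] at *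
      rw [le_iff] at hz1 hz2
      rcases hz1 with rfl | ⟨i, hi, hi'⟩
      · exact hu
      rcases hz2 with rfl | ⟨j, hj, hj'⟩
      · exact hv
      by_cases hin : i < n
      · rw [hu]; exact hi' n hin
      · by_cases hjn : j < n
        · rw [hv]; exact (hj' n hjn).symm
        · exfalso
          have huv : ∀ m, n ≤ m → c m u = c m v := fun m hm =>
            hup n m u v hm (hu.symm.trans hv)
          rcases lt_trichotomy i j with h | h | h
          · have := huv j (by omega); have := hi' j h; omega
          · subst h; have := huv i (by omega); omega
          · have := huv i (by omega); have := hj' i h; omega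

end LOC

namespace LOC

/-- coarse tournaments -/
def Tour {G : Type*} [Group G] (r : G → G → Prop) : Prop :=
  (∀ x y, x ≠ y → (r x y ↔ ¬ r y x)) ∧
  ∀ g : G, ∃ C : Finset G, ∀ x y : G, x * y⁻¹ ∉ C →
    (r (g * x) y ↔ r x y) ∧ (r x (g * y) ↔ r x y)

lemma tour_of_selector {G : Type*} [Group G] (f : Finset G → G) (hf : IsTwoSelector G f) :
    ∃ r : G → G → Prop, Tour r := by
  classical
  obtain ⟨h1, h2⟩ := hf
  let r : G → G → Prop := fun x y => f {x, y} = x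
  have hmem : ∀ x y, x ≠ y → f {x, y} = x ∨ f {x, y} = y := by
    intro x y hxy
    simpa using h1 {x, y} (Finset.card_pair hxy)
  have anti : ∀ x y, x ≠ y → (r x y ↔ ¬ r y x) := by
    intro x y hxy
    simp only [r, Finset.pair_comm y x]
    rcases hmem x y hxy with h | h
    · rw [h]; simp [hxy]
    · rw [h]; simp [hxy.symm]
  refine ⟨r, anti, ?_⟩
  intro g
  have one : ∃ C : Finset G, 1 ∈ C ∧ g⁻¹ ∈ C ∧
      ∀ x y : G, x * y⁻¹ ∉ C → (r (g * x) y ↔ r x y) := by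
    obtain ⟨F', hF1, hF2⟩ := h2 {1, g, g⁻¹} (by simp)
    refine ⟨{g⁻¹, 1} ∪ F' ∪ {g⁻¹} * F'⁻¹, by simp, by simp, ?_⟩
    intro x y hxy
    simp only [Finset.mem_union, not_or] at hxy
    obtain ⟨⟨ha, hb⟩, hc⟩ := hxy
    simp only [Finset.mem_insert, Finset.mem_singleton, not_or] at ha
    have hne : x ≠ y := by
      rintro rfl
      exact ha.2 (by simp)
    have hne' : g * x ≠ y := by
      rintro rfl
      exact ha.1 (by simp)
    have s1 : (({x, y} : Finset G) : Set G) ⊆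
        ((({1, g, g⁻¹} : Finset G) : Set G)) * (({g * x, y} : Finset G) : Set G) := by
      intro z hz
      simp only [Finset.coe_insert, Finset.coe_singleton, Set.mem_insert_iff,
        Set.mem_singleton_iff] at hz
      rcases hz with rfl | rfl
      · exact ⟨g⁻¹, by simp, g * z, by simp, by simp⟩
      · exact ⟨1, by simp, z, by simp, by simp⟩
    have s2 : (({g * x, y} : Finset G) : Set G) ⊆
        ((({1, g, g⁻¹} : Finset G) : Set G)) * (({x, y} : Finset G) : Set G) := by
      intro z hz
      simp only [Finset.coe_insert, Finset.coe_singleton, Set.mem_insert_iff,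
        Set.mem_singleton_iff] at hz
      rcases hz with rfl | rfl
      · exact ⟨g, by simp, x, by simp, by simp⟩
      · exact ⟨1, by simp, z, by simp, by simp⟩
    obtain ⟨u, hu, hu'⟩ := hF2 {x, y} {g * x, y} (Finset.card_pair hne) (Finset.card_pair hne')
      s1 s2
    simp only [r]
    rcases hmem x y hne with e1 | e1 <;> rcases hmem (g * x) y hne' with e2 | e2
    · simp [e1, e2]
    · exfalso
      rw [e1, e2] at hu'
      apply hb
      rw [hu']; simpa using hu
    · exfalso
      rw [e1, e2] at hu'
      apply hc
      rw [Finset.mem_mul]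
      refine ⟨g⁻¹, by simp, u⁻¹, by simpa using hu, ?_⟩
      rw [hu']; group
    · rw [e1, e2]
      constructor
      · intro h; exact absurd h.symm hne'
      · intro h; exact absurd h.symm hne
  obtain ⟨C, hC1, hCg, hC⟩ := one
  refine ⟨C ∪ C⁻¹, ?_⟩
  intro x y hxy
  simp only [Finset.mem_union, not_or, Finset.mem_inv', mul_inv_rev, inv_inv] at hxy
  refine ⟨hC x y hxy.1, ?_⟩
  have hne : x ≠ y := by
    rintro rfl
    exact hxy.1 (by simpa using hC1)
  have hne' : x ≠ g * y := by
    rintro rfl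
    exact hxy.2 (by simpa using hCg)
  rw [anti _ _ hne', anti _ _ hne, hC y x hxy.2]

lemma ev_far {G : Type*} [Group G] (C : Finset G) (y : G) :
    ∀ᶠ x in Filter.cofinite, x * y⁻¹ ∉ C := by
  have : {x | x * y⁻¹ ∈ C}.Finite :=
    (C.finite_toSet).preimage ((mul_left_injective y⁻¹).injOn)
  simpa [Filter.eventually_cofinite] using this

lemma exists_of_ev {G : Type*} {S : Set G} (hS : S.Infinite) {p : G → Prop}
    (hp : ∀ᶠ x in Filter.cofinite, p x) : ∃ x ∈ S, p x := by
  by_contra hc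
  push Not at hc
  rw [Filter.eventually_cofinite] at hp
  exact hS (hp.subset hc)

/-- key three point argument -/
lemma key_top {G : Type*} [Group G] {r : G → G → Prop}
    (anti : ∀ x y, x ≠ y → (r x y ↔ ¬ r y x)) (C : G → Finset G)
    (hC : ∀ g x y : G, x * y⁻¹ ∉ C g → (r (g * x) y ↔ r x y) ∧ (r x (g * y) ↔ r x y))
    (F : Set G) (hF : (Subgroup.closure F : Set G).Infinite) (S : Subgroup G)
    (hFS : F ⊆ S) (hCS : ∀ g ∈ F, (C g : Set G) ⊆ S) : S = ⊤ := by
  rw [Subgroup.eq_top_iff']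
  intro y
  by_contra hy
  have hcl : Subgroup.closure F ≤ S := (Subgroup.closure_le S).2 hFS
  have inv : ∀ s ∈ Subgroup.closure F, ∀ a, a ∉ S → ∀ b ∈ S, (r a (s * b) ↔ r a b) := by
    intro s hs
    induction hs using Subgroup.closure_induction with
    | mem g hg =>
      intro a ha b hb
      refine (hC g a b ?_).2
      intro hm
      have := S.mul_mem (hCS g hg hm) hb
      simp at this
      exact ha this
    | one => simp
    | mul u v hu hv ihu ihv =>
      intro a ha b hb
      rw [mul_assoc, ihu a ha _ (S.mul_mem (hcl hv) hb), ihv a ha b hb]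
    | inv u hu ih =>
      intro a ha b hb
      have := ih a ha (u⁻¹ * b) (S.mul_mem (S.inv_mem (hcl hu)) hb)
      rw [← this]; simp
  have pair : ∀ x ∈ Subgroup.closure F, ∀ x' ∈ Subgroup.closure F, x * x'⁻¹ ∉ C y →
      (r (y * x) 1 ↔ ¬ r (y * x') 1) := by
    intro x hx x' hx' hfar
    have n1 : y * x ∉ S := fun h => hy ((S.mul_mem_cancel_right (hcl hx)).1 h)
    have n2 : y * x' ∉ S := fun h => hy ((S.mul_mem_cancel_right (hcl hx')).1 h)
    have e1 := (hC y x x' hfar).1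
    have e2 := (hC y x x' hfar).2
    have i1 := inv x' hx' (y * x) n1 1 S.one_mem
    have i2 := inv x hx (y * x') n2 1 S.one_mem
    rw [mul_one] at i1 i2
    have : x ≠ y * x' := fun h => n2 (h ▸ hcl hx)
    rw [← i1, ← i2, e1, ← e2, anti _ _ this]
  obtain ⟨x1, hx1, -⟩ := exists_of_ev hF (Filter.Eventually.of_forall (fun _ => trivial) : ∀ᶠ _ in _, True)
  obtain ⟨x2, hx2, h21⟩ := exists_of_ev hF (ev_far (C y) x1)
  obtain ⟨x3, hx3, h31, h32⟩ := exists_of_ev hF ((ev_far (C y) x1).and (ev_far (C y) x2))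
  have a := pair _ hx2 _ hx1 h21
  have b := pair _ hx3 _ hx1 h31
  have c := pair _ hx3 _ hx2 h32
  tauto

lemma closure_countable {G : Type*} [Group G] (s : Set G) (hs : s.Countable) :
    (Subgroup.closure s : Set G).Countable := by
  have := hs.to_subtype
  rw [FreeGroup.closure_eq_range]
  have : Countable (FreeGroup s) := by
    unfold FreeGroup
    infer_instance
  rw [MonoidHom.coe_range]
  exact Set.countable_range _

lemma countable_of_tour {G : Type*} [Group G] {r : G → G → Prop} (hr : Tour r) : Countable G := by
  classical
  by_cases hG : Finite G
  · infer_instance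
  have : Infinite G := not_finite_iff_infinite.mp hG
  obtain ⟨anti, h⟩ := hr
  choose C hC using h
  let T : Set G := Set.range (Infinite.natEmbedding G)
  have hT : T.Infinite := Set.infinite_range_of_injective (Infinite.natEmbedding G).injective
  have hTc : T.Countable := Set.countable_range _
  have := key_top anti C hC T (hT.mono Subgroup.subset_closure)
    (Subgroup.closure (T ∪ ⋃ g ∈ T, (C g : Set G)))
    (fun x hx => Subgroup.subset_closure (Or.inl hx))
    (fun g hg x hx => Subgroup.subset_closure (Or.inr (Set.mem_biUnion hg hx)))
  have hc := closure_countable (T ∪ ⋃ g ∈ T, (C g : Set G))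
    (hTc.union (hTc.biUnion fun g _ => (C g).countable_toSet))
  rw [this] at hc
  simpa [Set.countable_univ_iff] using hc

lemma fg_of_tour {G : Type*} [Group G] {r : G → G → Prop} (hr : Tour r)
    (F : Finset G) (hF : (Subgroup.closure (F : Set G) : Set G).Infinite) :
    ∃ F' : Finset G, (∀ s ∈ F', s⁻¹ ∈ F') ∧
      ∀ p : G → Prop, p 1 → (∀ s ∈ F', ∀ x, p x → p (s * x)) → ∀ x, p x := by
  classical
  obtain ⟨anti, h⟩ := hr
  choose C hC using h
  let E : Finset G := F ∪ F.biUnion C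
  have := key_top anti C hC F hF (Subgroup.closure (E : Set G))
    (fun x hx => Subgroup.subset_closure (Finset.mem_coe.2 (Finset.mem_union_left _ hx)))
    (fun g hg x hx => Subgroup.subset_closure
      (Finset.mem_coe.2 (Finset.mem_union_right _ (Finset.mem_biUnion.2 ⟨g, hg, hx⟩))))
  refine ⟨E ∪ E⁻¹, ?_, ?_⟩
  · intro s hs
    simp only [Finset.mem_union, Finset.mem_inv', inv_inv] at *
    exact hs.symm
  · intro p h1 hs x
    have hx : x ∈ Subgroup.closure (E : Set G) := by rw [this]; trivial
    induction hx using Subgroup.closure_induction_left with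
    | one => exact h1
    | mul_left g hg y hy ih => exact hs g (Finset.mem_union_left _ hg) _ ih
    | inv_mul_cancel g hg y hy ih =>
      refine hs g⁻¹ (Finset.mem_union_right _ ?_) _ ih
      rw [Finset.mem_inv', inv_inv]
      exact hg

end LOC

namespace LOC

open Filter in
/-- almost left invariant sets -/
def AI {G : Type*} [Group G] (M : Set G) : Prop :=
  ∀ g : G, ∀ᶠ x in cofinite, (g * x ∈ M ↔ x ∈ M)

lemma AI.compl {G : Type*} [Group G] {M : Set G} (h : AI M) : AI Mᶜ := by
  intro g
  filter_upwards [h g] with x hx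
  simp [hx]

/-- connectivity to the identity -/
def Conn {G : Type*} [Group G] (F : Finset G) (D : Set G) : Prop :=
  1 ∈ D ∧ ∀ P : Set G, (∀ x ∈ D, ∀ s ∈ F, s * x ∈ D → (s * x ∈ P ↔ x ∈ P)) →
    ∀ x ∈ D, (x ∈ P ↔ 1 ∈ P)

lemma conn_point {G : Type*} [Group G] (F : Finset G)
    (hgen : ∀ p : G → Prop, p 1 → (∀ s ∈ F, ∀ x, p x → p (s * x)) → ∀ x, p x) (x : G) :
    ∃ D : Set G, D.Finite ∧ x ∈ D ∧ Conn F D := by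
  apply hgen (fun x => ∃ D : Set G, D.Finite ∧ x ∈ D ∧ Conn F D)
  · refine ⟨{1}, Set.finite_singleton _, rfl, rfl, ?_⟩
    rintro P - x rfl
    rfl
  · rintro s hs x ⟨D, hD, hx, h1, hc⟩
    refine ⟨insert (s * x) D, hD.insert _, Set.mem_insert _ _, Set.mem_insert_of_mem _ h1, ?_⟩
    intro P hP
    have hc' := hc P (fun z hz t ht htz =>
      hP z (Set.mem_insert_of_mem _ hz) t ht (Set.mem_insert_of_mem _ htz))
    intro z hz
    rcases hz with rfl | hz
    · rw [hP x (Set.mem_insert_of_mem _ hx) s hs (Set.mem_insert _ _), hc' x hx]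
    · exact hc' z hz

lemma conn_finite {G : Type*} [Group G] (F : Finset G)
    (hgen : ∀ p : G → Prop, p 1 → (∀ s ∈ F, ∀ x, p x → p (s * x)) → ∀ x, p x)
    (E : Set G) (hE : E.Finite) :
    ∃ D : Set G, D.Finite ∧ E ⊆ D ∧ Conn F D := by
  choose D hD hx hc using conn_point F hgen
  refine ⟨⋃ x ∈ insert 1 E, D x, (hE.insert 1).biUnion fun x _ => hD x, ?_, ?_, ?_⟩
  · intro x hxE
    exact Set.mem_biUnion (Set.mem_insert_of_mem _ hxE) (hx x)
  · exact Set.mem_biUnion (Set.mem_insert _ _) (hx 1)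
  · intro P hP x hxD
    simp only [Set.mem_iUnion] at hxD
    obtain ⟨i, hi, hxi⟩ := hxD
    refine (hc i).2 P ?_ x hxi
    intro z hz s hs hsz
    exact hP z (Set.mem_biUnion hi hz) s hs (Set.mem_biUnion hi hsz)

lemma conn_AI {G : Type*} [Group G] (F : Finset G) (hsym : ∀ s ∈ F, s⁻¹ ∈ F)
    (hgen : ∀ p : G → Prop, p 1 → (∀ s ∈ F, ∀ x, p x → p (s * x)) → ∀ x, p x)
    (M : Set G) (hM : AI M) (E : Set G) (hE : E.Finite) :
    ∃ D : Set G, D.Finite ∧ E ⊆ D ∧ Conn F (M ∪ D) := by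
  have hb : {x | ¬ ∀ s ∈ F, (s * x ∈ M ↔ x ∈ M)}.Finite := by
    have : ∀ᶠ x in Filter.cofinite, ∀ s ∈ F, (s * x ∈ M ↔ x ∈ M) :=
      (Filter.eventually_all_finset F).2 fun s _ => hM s
    exact this
  obtain ⟨D, hD, hED, h1, hc⟩ := conn_finite F hgen _ (hE.union hb)
  refine ⟨D, hD, Set.subset_union_left.trans hED, Or.inr h1, ?_⟩
  intro P hP
  have hcD := hc P (fun z hz s hs hsz => hP z (Or.inr hz) s hs (Or.inr hsz))
  apply hgen (fun x => x ∈ M ∪ D → (x ∈ P ↔ 1 ∈ P))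
  · intro _; rfl
  · intro s hs x ih hsx
    by_cases hx : x ∈ M ∪ D
    · rw [hP x hx s hs hsx, ih hx]
    · rcases hsx with hsx | hsx
      · apply hcD
        apply hED
        right
        intro hall
        have := hall s⁻¹ (hsym s hs)
        rw [inv_mul_cancel_left] at this
        exact hx (Or.inl (this.2 hsx))
      · exact hcD _ hsx

/-- bounded components are uniformly bounded -/
lemma fin_comp {G : Type*} [Group G] (F : Finset G) (hsym : ∀ s ∈ F, s⁻¹ ∈ F)
    (hgen : ∀ p : G → Prop, p 1 → (∀ s ∈ F, ∀ x, p x → p (s * x)) → ∀ x, p x)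
    (C : Finset G) (h1 : 1 ∈ C) :
    ∃ D : Set G, D.Finite ∧ ∀ T : Set G, T.Finite → (∀ x ∈ T, x ∉ C) →
      (∀ x ∈ T, ∀ s ∈ F, s * x ∈ T ∨ s * x ∈ C) → T ⊆ D := by
  classical
  let good : Set G → Prop := fun T => T.Finite ∧ (∀ x ∈ T, x ∉ C) ∧
      (∀ x ∈ T, ∀ s ∈ F, s * x ∈ T ∨ s * x ∈ C)
  have hch : ∀ b : G, ∃ T, good T ∧ ∀ T', good T' → b ∈ T' → b ∈ T := by
    intro b
    by_cases h : ∃ T', good T' ∧ b ∈ T'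
    · obtain ⟨T', h1, h2⟩ := h
      exact ⟨T', h1, fun _ _ _ => h2⟩
    · refine ⟨∅, ⟨Set.finite_empty, by simp, by simp⟩, ?_⟩
      intro T' h1 h2
      exact absurd ⟨T', h1, h2⟩ h
  choose U hU hU' using hch
  refine ⟨⋃ b ∈ (F * C : Finset G), U b, (Finset.finite_toSet _).biUnion fun b _ => (hU b).1, ?_⟩
  intro T hT1 hT2 hT3
  apply hgen (fun x => x ∈ T → x ∈ ⋃ b ∈ (F * C : Finset G), U b)
  · intro h; exact absurd h1 (hT2 _ h)
  · intro s hs x ih hsx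
    by_cases hx : x ∈ C
    · exact Set.mem_biUnion (Finset.mul_mem_mul hs hx) (hU' _ T ⟨hT1, hT2, hT3⟩ hsx)
    · have hxT : x ∈ T := by
        have := hT3 _ hsx _ (hsym s hs)
        rw [inv_mul_cancel_left] at this
        exact this.resolve_right hx
      have := ih hxT
      simp only [Set.mem_iUnion] at this ⊢
      obtain ⟨b, hb, hxb⟩ := this
      refine ⟨b, hb, ?_⟩
      exact ((hU b).2.2 x hxb s hs).resolve_right (hT2 _ hsx)

lemma Tour.flip {G : Type*} [Group G] {r : G → G → Prop} (hr : Tour r) :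
    Tour (fun x y => r y x) := by
  classical
  refine ⟨fun x y hxy => hr.1 y x hxy.symm, ?_⟩
  intro g
  obtain ⟨C, hC⟩ := hr.2 g
  refine ⟨C⁻¹, ?_⟩
  intro x y hxy
  simp only [Finset.mem_inv', mul_inv_rev, inv_inv] at hxy
  exact ⟨(hC y x hxy).2, (hC y x hxy).1⟩

lemma Tour.unif {G : Type*} [Group G] {r : G → G → Prop} (hr : Tour r) (F : Finset G) :
    ∃ C : Finset G, 1 ∈ C ∧ ∀ s ∈ F, ∀ x y : G, x * y⁻¹ ∉ C → (r (s * x) y ↔ r x y) := by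
  classical
  have h := hr.2
  choose C hC using h
  refine ⟨insert 1 (F.biUnion C), by simp, ?_⟩
  intro s hs x y hxy
  refine (hC s x y ?_).1
  intro h
  exact hxy (Finset.mem_insert_of_mem (Finset.mem_biUnion.2 ⟨s, hs, h⟩))

lemma Tour.AI {G : Type*} [Group G] {r : G → G → Prop} (hr : Tour r) (y : G) :
    AI {x | r x y} := by
  intro g
  obtain ⟨C, hC⟩ := hr.2 g
  filter_upwards [ev_far C y] with x hx
  exact (hC x y hx).1

lemma Tour.ae {G : Type*} [Group G] {r : G → G → Prop} (hr : Tour r) (y : G) :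
    ∀ᶠ x in Filter.cofinite, (r x y ↔ r x 1) := by
  obtain ⟨C, hC⟩ := hr.2 y
  filter_upwards [ev_far C 1] with x hx
  have := (hC x 1 hx).2
  rwa [mul_one] at this

lemma Tour.inf {G : Type*} [Group G] [Infinite G] {r : G → G → Prop} (hr : Tour r)
    (F : Finset G) (hsym : ∀ s ∈ F, s⁻¹ ∈ F)
    (hgen : ∀ p : G → Prop, p 1 → (∀ s ∈ F, ∀ x, p x → p (s * x)) → ∀ x, p x) :
    {x | r x 1}.Infinite := by
  intro hfin
  have hev : ∀ᶠ x in Filter.cofinite, ¬ r x 1 := by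
    rw [Filter.eventually_cofinite]; simpa using hfin
  obtain ⟨C, h1, hC⟩ := hr.unif F
  obtain ⟨D, hD, hT⟩ := fin_comp F hsym hgen C h1
  have hL : ∀ y, {x | r x y}.Finite := by
    intro y
    have : ∀ᶠ x in Filter.cofinite, ¬ r x y := by
      filter_upwards [hr.ae y, hev] with x h1 h2
      rwa [h1]
    rw [Filter.eventually_cofinite] at this
    simpa using this
  have hsub : ∀ y, {g | r (g * y) y ∧ g ∉ C} ⊆ D := by
    intro y
    apply hT
    · have : {g | r (g * y) y}.Finite := (hL y).preimage ((mul_left_injective y).injOn)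
      exact this.subset fun g hg => hg.1
    · intro x hx; exact hx.2
    · intro x hx s hs
      by_cases hsx : s * x ∈ C
      · exact Or.inr hsx
      · refine Or.inl ⟨?_, hsx⟩
        rw [mul_assoc, hC s hs (x * y) y (by simpa using hx.2)]
        exact hx.1
  have huniv : (Set.univ : Set G) ⊆ {x | r x 1} ∪ {1} ∪ (Inv.inv ⁻¹' (D ∪ C)) := by
    intro y _
    by_contra hc
    simp only [Set.mem_union, not_or, Set.mem_preimage, Set.mem_singleton_iff] at hc
    obtain ⟨⟨ha, hb⟩, hd, he⟩ := hc
    apply hd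
    apply hsub y
    refine ⟨?_, he⟩
    rw [inv_mul_cancel]
    rw [hr.1 _ _ (Ne.symm hb)]
    exact ha
  exact Set.infinite_univ (((hfin.union (Set.finite_singleton 1)).union
    ((hD.union C.finite_toSet).preimage inv_injective.injOn)).subset huniv)

lemma Tour.inf' {G : Type*} [Group G] [Infinite G] {r : G → G → Prop} (hr : Tour r)
    (F : Finset G) (hsym : ∀ s ∈ F, s⁻¹ ∈ F)
    (hgen : ∀ p : G → Prop, p 1 → (∀ s ∈ F, ∀ x, p x → p (s * x)) → ∀ x, p x) :
    {x | r x 1}ᶜ.Infinite := by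
  have h := hr.flip.inf F hsym hgen
  have h2 : ({x | r 1 x} \ {1}).Infinite := h.diff (Set.finite_singleton 1)
  refine h2.mono ?_
  rintro x ⟨hx, hx1⟩
  exact (hr.1 1 x (fun h => hx1 h.symm)).1 hx

/-- an infinite almost invariant set leaves only one side -/
lemma Tour.side {G : Type*} [Group G] {r : G → G → Prop} (hr : Tour r)
    (F : Finset G) (hsym : ∀ s ∈ F, s⁻¹ ∈ F)
    (hgen : ∀ p : G → Prop, p 1 → (∀ s ∈ F, ∀ x, p x → p (s * x)) → ∀ x, p x)
    (B : Set G) (hB : LOC.AI B) (hBi : B.Infinite) :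
    (∀ᶠ x in Filter.cofinite, x ∉ B → ¬ r x 1) ∨ (∀ᶠ x in Filter.cofinite, x ∉ B → r x 1) := by
  by_contra hcon
  rw [not_or] at hcon
  obtain ⟨hc1, hc2⟩ := hcon
  obtain ⟨C, h1, hC⟩ := hr.unif F
  obtain ⟨D, hD, -, hconn⟩ := conn_AI F hsym hgen Bᶜ hB.compl ∅ Set.finite_empty
  have hy : ∀ᶠ y in Filter.cofinite, ∀ c ∈ C, (c * y ∈ B ↔ y ∈ B) ∧ c * y ∉ D := by
    refine (Filter.eventually_all_finset C).2 fun c _ => (hB c).and ?_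
    have : {y | c * y ∈ D}.Finite := hD.preimage (mul_right_injective c).injOn
    simpa [Filter.eventually_cofinite] using this
  obtain ⟨y, hyB, hy⟩ := exists_of_ev hBi hy
  have hconst := hconn.2 {x | r x y} (by
    intro x hx s hs _
    apply hC s hs x y
    intro hm
    have := hy _ hm
    rw [inv_mul_cancel_right] at this
    rcases hx with hx | hx
    · exact hx (this.1.2 hyB)
    · exact this.2 hx)
  have f1 : ∃ x, x ∉ B ∧ r x y := by
    by_contra hne
    push Not at hne
    apply hc1
    filter_upwards [hr.ae y] with x hx hxB
    rw [← hx]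
    exact hne x hxB
  have f2 : ∃ x, x ∉ B ∧ ¬ r x y := by
    by_contra hne
    push Not at hne
    apply hc2
    filter_upwards [hr.ae y] with x hx hxB
    rw [← hx]
    exact hne x hxB
  obtain ⟨u, hu, hu'⟩ := f1
  obtain ⟨v, hv, hv'⟩ := f2
  have e1 := hconst u (Or.inl hu)
  have e2 := hconst v (Or.inl hv)
  exact hv' (e2.2 (e1.1 hu'))

lemma inf_ev {G : Type*} {S : Set G} (hS : S.Infinite)
    (hp : ∀ᶠ x in Filter.cofinite, x ∉ S) : False := by
  obtain ⟨x, h1, h2⟩ := exists_of_ev hS hp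
  exact h2 h1

lemma Tour.dich {G : Type*} [Group G] [Infinite G] {r : G → G → Prop} (hr : Tour r)
    (F : Finset G) (hsym : ∀ s ∈ F, s⁻¹ ∈ F)
    (hgen : ∀ p : G → Prop, p 1 → (∀ s ∈ F, ∀ x, p x → p (s * x)) → ∀ x, p x) (h : G) :
    (∀ᶠ x in Filter.cofinite, (r (x * h) 1 ↔ r x 1)) ∨
    (∀ᶠ x in Filter.cofinite, (r (x * h) 1 ↔ ¬ r x 1)) := by
  have hL := hr.inf F hsym hgen
  have hL' := hr.inf' F hsym hgen
  have tend : Filter.Tendsto (fun x : G => x * h) Filter.cofinite Filter.cofinite :=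
    (mul_left_injective h).tendsto_cofinite
  have hM : LOC.AI {x | r (x * h) 1} := by
    intro g
    filter_upwards [tend.eventually (hr.AI 1 g)] with x hx
    simpa [mul_assoc] using hx
  have surj : ∀ z : G, z * h⁻¹ * h = z := fun z => by simp
  have hM1 : {x | r (x * h) 1}.Infinite := by
    intro hf
    refine hL ((hf.image (fun x => x * h)).subset ?_)
    intro z hz
    exact ⟨z * h⁻¹, by simpa using hz, by simp⟩
  have hM2 : {x | r (x * h) 1}ᶜ.Infinite := by
    intro hf
    refine hL' ((hf.image (fun x => x * h)).subset ?_)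
    intro z hz
    exact ⟨z * h⁻¹, by simpa using hz, by simp⟩
  rcases hr.side F hsym hgen _ hM hM1 with a | a <;>
    rcases hr.side F hsym hgen _ hM.compl hM2 with b | b
  · exfalso
    apply inf_ev hL
    filter_upwards [a, b] with x ha hb
    by_cases hx : r (x * h) 1
    · exact hb (by simpa using hx)
    · exact ha hx
  · left
    filter_upwards [a, b] with x ha hb
    simp at ha hb
    tauto
  · right
    filter_upwards [a, b] with x ha hb
    simp at ha hb
    tauto
  · exfalso
    apply inf_ev hL'
    filter_upwards [a, b] with x ha hb
    simp at ha hb ⊢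
    tauto

end LOC

namespace LOC

/-- relative size of almost equal sets -/
noncomputable def idx {G : Type*} (A B : Set G) : ℤ := ((A \ B).ncard : ℤ) - ((B \ A).ncard : ℤ)

/-- almost equality -/
def AEq {G : Type*} (A B : Set G) : Prop := ∀ᶠ x in Filter.cofinite, (x ∈ A ↔ x ∈ B)

lemma idx_eq {G : Type*} (A B U : Set G) (hU : U.Finite) (h1 : A \ B ⊆ U) (h2 : B \ A ⊆ U) :
    idx A B = ((A ∩ U).ncard : ℤ) - ((B ∩ U).ncard : ℤ) := by
  have e1 := Set.ncard_inter_add_ncard_diff_eq_ncard (A ∩ U) B (hU.subset Set.inter_subset_right)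
  have e2 := Set.ncard_inter_add_ncard_diff_eq_ncard (B ∩ U) A (hU.subset Set.inter_subset_right)
  have f1 : (A ∩ U) \ B = A \ B := by
    ext x; constructor
    · rintro ⟨⟨a, _⟩, b⟩; exact ⟨a, b⟩
    · rintro h; exact ⟨⟨h.1, h1 h⟩, h.2⟩
  have f2 : (B ∩ U) \ A = B \ A := by
    ext x; constructor
    · rintro ⟨⟨a, _⟩, b⟩; exact ⟨a, b⟩
    · rintro h; exact ⟨⟨h.1, h2 h⟩, h.2⟩
  have f3 : (A ∩ U) ∩ B = (B ∩ U) ∩ A := by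
    ext x; simp only [Set.mem_inter_iff]; tauto
  rw [f1] at e1
  rw [f2, ← f3] at e2
  unfold idx
  omega

lemma AEq.finite {G : Type*} {A B : Set G} (h : AEq A B) : {x | ¬ (x ∈ A ↔ x ∈ B)}.Finite := h

lemma idx_add {G : Type*} {A B C : Set G} (h1 : AEq A B) (h2 : AEq B C) :
    idx A C = idx A B + idx B C := by
  let U : Set G := {x | ¬ (x ∈ A ↔ x ∈ B)} ∪ {x | ¬ (x ∈ B ↔ x ∈ C)}
  have hU : U.Finite := h1.finite.union h2.finite
  have m : ∀ x, x ∈ U ↔ (¬ (x ∈ A ↔ x ∈ B) ∨ ¬ (x ∈ B ↔ x ∈ C)) := fun x => Iff.rfl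
  rw [idx_eq A C U hU (fun x hx => by rw [m]; have := hx.1; have := hx.2; tauto)
        (fun x hx => by rw [m]; have := hx.1; have := hx.2; tauto),
    idx_eq A B U hU (fun x hx => by rw [m]; have := hx.1; have := hx.2; tauto)
        (fun x hx => by rw [m]; have := hx.1; have := hx.2; tauto),
    idx_eq B C U hU (fun x hx => by rw [m]; have := hx.1; have := hx.2; tauto)
        (fun x hx => by rw [m]; have := hx.1; have := hx.2; tauto)]
  ring

lemma idx_compl {G : Type*} (A B : Set G) : idx Aᶜ Bᶜ = - idx A B := by
  unfold idx
  have e : ∀ A B : Set G, Aᶜ \ Bᶜ = B \ A := by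
    intro A B
    ext x
    simp only [Set.mem_sdiff, Set.mem_compl_iff]
    tauto
  rw [e, e]
  ring

/-- right translate -/
def Rt {G : Type*} [Group G] (h : G) (A : Set G) : Set G := {x | x * h ∈ A}

lemma Rt_mul {G : Type*} [Group G] (g h : G) (A : Set G) : Rt (g * h) A = Rt g (Rt h A) := by
  ext x; simp [Rt, mul_assoc]

lemma Rt_compl {G : Type*} [Group G] (h : G) (A : Set G) : Rt h Aᶜ = (Rt h A)ᶜ := rfl

lemma Rt_one {G : Type*} [Group G] (A : Set G) : Rt 1 A = A := by
  ext x; simp [Rt]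

lemma ncard_Rt {G : Type*} [Group G] (h : G) (A : Set G) : (Rt h A).ncard = A.ncard := by
  have : A = (fun x => x * h) '' (Rt h A) := by
    ext z
    constructor
    · intro hz; exact ⟨z * h⁻¹, by simpa [Rt] using hz, by simp⟩
    · rintro ⟨x, hx, rfl⟩; exact hx
  conv_rhs => rw [this]
  rw [Set.ncard_image_of_injective _ (mul_left_injective h)]

lemma idx_Rt {G : Type*} [Group G] (h : G) (A B : Set G) : idx (Rt h A) (Rt h B) = idx A B := by
  unfold idx
  have e : ∀ A B : Set G, Rt h A \ Rt h B = Rt h (A \ B) := fun A B => rfl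
  rw [e, e, ncard_Rt, ncard_Rt]

lemma AEq.Rt {G : Type*} [Group G] (h : G) {A B : Set G} (hAB : AEq A B) :
    AEq (Rt h A) (Rt h B) :=
  ((mul_left_injective h).tendsto_cofinite : Filter.Tendsto (fun x : G => x * h) _ _).eventually hAB

lemma AEq.trans {G : Type*} {A B C : Set G} (h1 : AEq A B) (h2 : AEq B C) : AEq A C := by
  filter_upwards [h1, h2] with x a b
  rw [a, b]

lemma AEq.symm {G : Type*} {A B : Set G} (h1 : AEq A B) : AEq B A := by
  filter_upwards [h1] with x a
  rw [a]

lemma AEq.compl {G : Type*} {A B : Set G} (h1 : AEq A B) : AEq Aᶜ Bᶜ := by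
  filter_upwards [h1] with x a
  simp [a]

/-- deep translations are strictly nested -/
lemma nested {G : Type*} [Group G] (F : Finset G) (hsym : ∀ s ∈ F, s⁻¹ ∈ F)
    (hgen : ∀ p : G → Prop, p 1 → (∀ s ∈ F, ∀ x, p x → p (s * x)) → ∀ x, p x)
    (L : Set G) (hL : AI L) (h1 : L.Infinite) (h2 : Lᶜ.Infinite) :
    ∀ᶠ g in Filter.cofinite, g ∈ L → AEq (Rt g⁻¹ L) L → idx (Rt g⁻¹ L) L < 0 := by
  obtain ⟨l, hl⟩ := h1.nonempty
  obtain ⟨D, hD, hlD, hconn⟩ := conn_AI F hsym hgen Lᶜ hL.compl {l} (Set.finite_singleton l)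
  have hb : {x | ¬ ∀ s ∈ F, (s * x ∈ L ↔ x ∈ L)}.Finite := by
    have : ∀ᶠ x in Filter.cofinite, ∀ s ∈ F, (s * x ∈ L ↔ x ∈ L) :=
      (Filter.eventually_all_finset F).2 fun s _ => hL s
    exact this
  have hy : ∀ᶠ y in Filter.cofinite, ∀ c ∈ {x | ¬ ∀ s ∈ F, (s * x ∈ L ↔ x ∈ L)},
      (c * y ∈ L ↔ y ∈ L) ∧ c * y ∉ D := by
    refine (Filter.eventually_all_finite hb).2 fun c _ => (hL c).and ?_
    have : {y | c * y ∈ D}.Finite := hD.preimage (mul_right_injective c).injOn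
    simpa [Filter.eventually_cofinite] using this
  filter_upwards [hy] with g hg hgL hae
  have hconst := hconn.2 (Rt g⁻¹ L) (by
    intro x hx s hs _
    have hx' : x * g⁻¹ ∉ {x | ¬ ∀ s ∈ F, (s * x ∈ L ↔ x ∈ L)} := by
      intro hm
      have := hg _ hm
      rw [inv_mul_cancel_right] at this
      rcases hx with hx | hx
      · exact hx (this.1.2 hgL)
      · exact this.2 hx
    have hx'' : ∀ s ∈ F, (s * (x * g⁻¹) ∈ L ↔ x * g⁻¹ ∈ L) := not_not.1 hx'
    simpa [Rt, mul_assoc] using hx'' s hs)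
  obtain ⟨u, hu, hu'⟩ := exists_of_ev h2 hae
  have hun : u ∉ Rt g⁻¹ L := fun h => hu (hu'.1 h)
  have hone : 1 ∉ Rt g⁻¹ L := fun h => hun ((hconst u (Or.inl hu)).2 h)
  have hall : ∀ x ∈ Lᶜ ∪ D, x ∉ Rt g⁻¹ L := fun x hx h => hone ((hconst x hx).1 h)
  have e1 : Rt g⁻¹ L \ L = ∅ := by
    ext x
    simp only [Set.mem_sdiff, Set.mem_empty_iff_false, iff_false, not_and, not_not]
    intro hx
    by_contra hxL
    exact hall x (Or.inl hxL) hx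
  have e2 : 0 < (L \ Rt g⁻¹ L).ncard := by
    have hfin : (L \ Rt g⁻¹ L).Finite := by
      refine hae.finite.subset ?_
      rintro x ⟨ha, hb⟩ hc
      exact hb (hc.2 ha)
    rw [Set.ncard_pos hfin]
    exact ⟨l, hl, hall l (Or.inr (hlD rfl))⟩
  unfold idx
  rw [e1]
  simp only [Set.ncard_empty]
  omega

lemma interval_two_ended {G : Type*} [Group G] (F : Finset G) (hsym : ∀ s ∈ F, s⁻¹ ∈ F)
    (hgen : ∀ p : G → Prop, p 1 → (∀ s ∈ F, ∀ x, p x → p (s * x)) → ∀ x, p x)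
    (L : Set G) (hL : AI L) (h1 : L.Infinite) (h2 : Lᶜ.Infinite)
    (hd : ∀ h, AEq (Rt h L) L ∨ AEq (Rt h L) Lᶜ) :
    ∃ lo : LinearOrder G, IntervalWrt G lo := by
  classical
  let H : G → Prop := fun h => AEq (Rt h L) L
  let φ : G → ℤ := fun h => idx (Rt h L) L
  have Hone : H 1 := by
    change AEq (Rt 1 L) L
    rw [Rt_one]
    exact Filter.Eventually.of_forall fun _ => Iff.rfl
  have Hmul : ∀ g h, H g → H h → H (g * h) := by
    intro g h hg hh
    change AEq (Rt (g * h) L) L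
    rw [Rt_mul]
    exact (AEq.Rt g hh).trans hg
  have Hinv : ∀ g, H g → H g⁻¹ := by
    intro g hg
    have := AEq.Rt g⁻¹ hg
    rw [← Rt_mul, inv_mul_cancel, Rt_one] at this
    exact this.symm
  have Hnn : ∀ g h, ¬ H g → ¬ H h → H (g * h) := by
    intro g h hg hh
    change AEq (Rt (g * h) L) L
    rw [Rt_mul]
    have a := (hd g).resolve_left hg
    have b := (hd h).resolve_left hh
    have c := AEq.Rt g b
    rw [Rt_compl] at c
    have d := a.compl
    rw [compl_compl] at d
    exact c.trans d
  have φmul : ∀ g h, H g → H h → φ (g * h) = φ g + φ h := by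
    intro g h hg hh
    change idx (Rt (g * h) L) L = _
    rw [Rt_mul, idx_add (AEq.Rt g hh) hg, idx_Rt]
    exact add_comm _ _
  have φone : φ 1 = 0 := by
    have := φmul 1 1 Hone Hone
    rw [mul_one] at this
    omega
  have φinv : ∀ g, H g → φ g⁻¹ = - φ g := by
    intro g hg
    have := φmul g g⁻¹ hg (Hinv g hg)
    rw [mul_inv_cancel, φone] at this
    omega
  have Hnot_inv : ∀ t, ¬ H t → ¬ H t⁻¹ := by
    intro t ht h
    apply ht
    simpa using Hinv _ h
  have φconj : ∀ t h, ¬ H t → H h → H (t * h * t⁻¹) ∧ φ (t * h * t⁻¹) = - φ h := by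
    intro t h ht hh
    have hth : ¬ H (t * h) := by
      intro hc
      apply ht
      have := Hmul _ _ hc (Hinv h hh)
      simpa using this
    refine ⟨Hnn _ _ hth (Hnot_inv t ht), ?_⟩
    -- translate everything by t inverse
    have a : AEq (Rt t⁻¹ L) Lᶜ := (hd t⁻¹).resolve_left (Hnot_inv t ht)
    have b : AEq L (Rt t Lᶜ) := by
      have := AEq.Rt t a
      rwa [← Rt_mul, mul_inv_cancel, Rt_one] at this
    change idx (Rt (t * h * t⁻¹) L) L = - idx (Rt h L) L
    -- idx (Rt t (Rt h (Rt t⁻¹ L))) (Rt t (Rt t⁻¹ L))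
    have e : idx (Rt (t * h * t⁻¹) L) L = idx (Rt h (Rt t⁻¹ L)) (Rt t⁻¹ L) := by
      rw [← idx_Rt t (Rt h (Rt t⁻¹ L)), ← Rt_mul, ← Rt_mul, ← Rt_mul, mul_inv_cancel, Rt_one,
        mul_assoc]
    have hc : AEq (Rt h Lᶜ) Lᶜ := hh.compl
    have hac := AEq.Rt h a
    rw [e, idx_add (hac.trans hc) a.symm, idx_add hac hc, idx_Rt, Rt_compl, idx_compl]
    have z := idx_add a a.symm
    have z' : idx (Rt t⁻¹ L) (Rt t⁻¹ L) = 0 := by unfold idx; simp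
    omega
  have hker : {h | H h ∧ φ h = 0}.Finite := by
    have a := nested F hsym hgen L hL h1 h2
    have b := nested F hsym hgen Lᶜ hL.compl h2 (by rwa [compl_compl])
    have key : ∀ᶠ g in Filter.cofinite, ¬ (H g⁻¹ ∧ φ g⁻¹ = 0) := by
      filter_upwards [a, b] with g ha hb
      rintro ⟨hH, h0⟩
      by_cases hg : g ∈ L
      · have := ha hg hH
        change idx (Rt g⁻¹ L) L = 0 at h0
        omega
      · have := hb hg hH.compl
        rw [Rt_compl, idx_compl] at this
        change idx (Rt g⁻¹ L) L = 0 at h0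
        omega
    have f : {g | H g⁻¹ ∧ φ g⁻¹ = 0}.Finite := by
      rw [Filter.eventually_cofinite] at key
      simpa using key
    refine (f.preimage (inv_injective.injOn)).subset ?_
    intro g hg
    simpa using hg
  have hfib : ∀ v : ℤ, {h | H h ∧ φ h = v}.Finite := by
    intro v
    by_cases hne : ∃ h0, H h0 ∧ φ h0 = v
    · obtain ⟨h0, ha, hb⟩ := hne
      refine (hker.image (fun k => h0 * k)).subset ?_
      rintro h ⟨hc, hd⟩
      refine ⟨h0⁻¹ * h, ⟨Hmul _ _ (Hinv _ ha) hc, ?_⟩, by simp⟩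
      rw [φmul _ _ (Hinv _ ha) hc, φinv _ ha]
      omega
    · refine Set.finite_empty.subset ?_
      intro h hh
      exact hne ⟨h, hh⟩
  have hball : ∀ n : ℤ, {h | H h ∧ |φ h| ≤ n}.Finite := by
    intro n
    refine ((Set.finite_Icc (-n) n).biUnion fun v _ => hfib v).subset ?_
    rintro h ⟨ha, hb⟩
    exact Set.mem_biUnion (Set.mem_Icc.2 (abs_le.1 hb)) ⟨ha, rfl⟩
  by_cases hall : ∀ h, H h
  · apply interval_of_coord φ
    · intro z x
      rw [φmul _ _ (hall _) (hall _), φinv _ (hall _), sub_eq_add_neg]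
    · intro n
      exact (hball n).subset fun h hh => ⟨hall h, hh⟩
  · push Not at hall
    obtain ⟨t, ht⟩ := hall
    have htt : H (t * t) := Hnn t t ht ht
    have φtt : φ (t * t) = 0 := by
      have := (φconj t (t * t) ht htt).2
      have e : t * (t * t) * t⁻¹ = t * t := by group
      rw [e] at this
      omega
    have tH : ∀ k, H k → ¬ H (t * k) := by
      intro k hk hc
      apply ht
      simpa using Hmul _ _ hc (Hinv k hk)
    let p : G → ℤ := fun g => if H g then φ g else φ (t⁻¹ * g)
    have pH : ∀ k, H k → p k = φ k := fun k hk => if_pos hk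
    have pt : ∀ k, H k → p (t * k) = φ k := by
      intro k hk
      simp only [p, if_neg (tH k hk), inv_mul_cancel_left]
    have cases : ∀ g, H g ∨ ∃ k, H k ∧ g = t * k := by
      intro g
      by_cases hg : H g
      · exact Or.inl hg
      · exact Or.inr ⟨t⁻¹ * g, Hnn _ _ (Hnot_inv t ht) hg, by simp⟩
    apply interval_of_coord p
    · intro z x
      have quot : ∀ a b, H a → H b → H (a * b⁻¹) ∧ φ (a * b⁻¹) = φ a - φ b := by
        intro a b ha hb
        refine ⟨Hmul _ _ ha (Hinv _ hb), ?_⟩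
        rw [φmul _ _ ha (Hinv _ hb), φinv _ hb, sub_eq_add_neg]
      rcases cases z with hz | ⟨a, ha, rfl⟩ <;> rcases cases x with hx | ⟨b, hb, rfl⟩
      · obtain ⟨q1, q2⟩ := quot z x hz hx
        rw [pH _ q1, pH _ hz, pH _ hx, q2]
      · obtain ⟨q1, q2⟩ := quot z b hz hb
        have e : z * (t * b)⁻¹ = t * ((t⁻¹ * (z * b⁻¹) * t⁻¹⁻¹) * (t * t)⁻¹) := by group
        obtain ⟨c1, c2⟩ := φconj t⁻¹ (z * b⁻¹) (Hnot_inv t ht) q1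
        rw [e, pt _ (Hmul _ _ c1 (Hinv _ htt)), pt _ hb, pH _ hz, φmul _ _ c1 (Hinv _ htt),
          φinv _ htt, φtt, c2, q2]
        rw [neg_zero, add_zero, abs_neg]
      · obtain ⟨q1, q2⟩ := quot a x ha hx
        rw [mul_assoc, pt _ q1, pt _ ha, pH _ hx, q2]
      · obtain ⟨q1, q2⟩ := quot a b ha hb
        have e : t * a * (t * b)⁻¹ = t * (a * b⁻¹) * t⁻¹ := by group
        obtain ⟨c1, c2⟩ := φconj t (a * b⁻¹) ht q1
        rw [e, pH _ c1, pt _ ha, pt _ hb, c2, q2, abs_neg]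
    · intro n
      refine ((hball n).union ((hball n).image (fun k => t * k))).subset ?_
      intro g hg
      have hg' : |p g| ≤ n := hg
      rcases cases g with h | ⟨k, hk, rfl⟩
      · left
        rw [pH _ h] at hg'
        exact ⟨h, hg'⟩
      · right
        rw [pt _ hk] at hg'
        exact ⟨k, ⟨hk, hg'⟩, rfl⟩

lemma interval_of_tour {G : Type*} [Group G] {r : G → G → Prop} (hr : Tour r) :
    ∃ lo : LinearOrder G, IntervalWrt G lo := by
  by_cases hlf : ∀ F : Finset G, (Subgroup.closure (F : Set G) : Set G).Finite
  · have := countable_of_tour hr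
    exact interval_of_locally_finite hlf
  · push Not at hlf
    obtain ⟨F0, hF0⟩ := hlf
    have : Infinite G := Set.infinite_univ_iff.1 (Set.Infinite.mono (Set.subset_univ _) hF0)
    obtain ⟨F, hsym, hgen⟩ := fg_of_tour hr F0 hF0
    exact interval_two_ended F hsym hgen {x | r x 1} (hr.AI 1) (hr.inf F hsym hgen)
      (hr.inf' F hsym hgen) (hr.dich F hsym hgen)

end LOC

theorem linear_order_characterization (G : Type*) [Group G] :
    ((∃ lo : LinearOrder G, IntervalWrt G lo) ↔ (∃ lo : LinearOrder G, CompatibleWrt G lo)) ∧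
    ((∃ lo : LinearOrder G, CompatibleWrt G lo) ↔ (∃ f : Finset G → G, IsTwoSelector G f)) := by
  have h1 : (∃ lo : LinearOrder G, IntervalWrt G lo) → (∃ lo : LinearOrder G, CompatibleWrt G lo) :=
    fun ⟨lo, h⟩ => ⟨lo, LOC.interval_compat lo h⟩
  have h2 : (∃ lo : LinearOrder G, CompatibleWrt G lo) → (∃ f : Finset G → G, IsTwoSelector G f) :=
    fun ⟨lo, h⟩ => LOC.compat_selector lo h
  have h3 : (∃ f : Finset G → G, IsTwoSelector G f) → (∃ lo : LinearOrder G, IntervalWrt G lo) := by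
    rintro ⟨f, hf⟩
    obtain ⟨r, hr⟩ := LOC.tour_of_selector f hf
    exact LOC.interval_of_tour hr
  exact ⟨⟨h1, fun h => h3 (h2 h)⟩, ⟨h2, fun h => h1 (h3 h)⟩⟩
end

section
/- If a group G contains an infinite cyclic subgroup of finite index, then there exists a linear order ≤ on G such that the finitary coarse structure of G is interval with respect to ≤. -/
open scoped Pointwise

theorem interval_of_crossed {G : Type*} [Group G] (φ ε : G → ℤ)
    (hε : ∀ g, ε g = 1 ∨ ε g = -1)
    (hφ : ∀ g x, φ (g * x) = φ x + ε x * φ g)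
    (hfin : ∀ k : ℤ, (φ ⁻¹' {k}).Finite) :
    ∃ lo : LinearOrder G, IntervalWrt G lo := by
  classical
  obtain ⟨lo, hlo⟩ : ∃ lo : LinearOrder G, ∀ x y : G, lo.le x y → φ x ≤ φ y := by
    letI l0 : LinearOrder G := linearOrderOfSTO WellOrderingRel
    refine ⟨LinearOrder.lift' (fun g : G => (toLex (φ g, g) : ℤ ×ₗ G)) ?_, ?_⟩
    · intro x y h
      have := congrArg (fun z => (ofLex z).2) h
      simpa using this
    · intro x y h
      have h' : (toLex (φ x, x) : ℤ ×ₗ G) ≤ toLex (φ y, y) := h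
      rw [Prod.Lex.toLex_le_toLex] at h'
      rcases h' with h' | h'
      · exact le_of_lt h'
      · exact le_of_eq h'.1
  refine ⟨lo, ?_⟩
  have hball : ∀ c n : ℤ, {z : G | |φ z - c| ≤ n}.Finite := by
    intro c n
    have : {z : G | |φ z - c| ≤ n} ⊆ ⋃ k ∈ Set.Icc (c - n) (c + n), φ ⁻¹' {k} := by
      intro z hz
      have := abs_le.1 (show |φ z - c| ≤ n from hz)
      simp only [Set.mem_iUnion]
      exact ⟨φ z, ⟨by linarith, by linarith⟩, rfl⟩
    exact (Set.Finite.biUnion (Set.finite_Icc _ _) (fun k _ => hfin k)).subset this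
  intro F h1
  set n : ℤ := ∑ g ∈ F, |φ g| with hn
  have hFn : ∀ g ∈ F, |φ g| ≤ n := fun g hg =>
    Finset.single_le_sum (f := fun g => |φ g|) (fun i _ => abs_nonneg _) hg
  refine ⟨(hball 0 n).toFinset, ?_, ?_, ?_⟩
  · intro g hg
    simpa using hFn g hg
  · simpa using hFn 1 h1
  · intro x
    have hn0 : 0 ≤ n := Finset.sum_nonneg fun i _ => abs_nonneg _
    set S := (hball (φ x) n).toFinset with hS
    have memS : ∀ z, z ∈ S ↔ |φ z - φ x| ≤ n := by intro z; simp [hS]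
    have hx : x ∈ S := by rw [memS]; simpa using hn0
    have hne : S.Nonempty := ⟨x, hx⟩
    refine ⟨S.min' hne, S.max' hne, S.min'_le x hx, S.le_max' x hx, ?_⟩
    ext z
    have e1 : z ∈ (((hball 0 n).toFinset : Set G) * {x} : Set G) ↔ z ∈ S := by
      rw [memS, Set.mul_singleton]
      simp only [Set.mem_image, Finset.mem_coe, Set.Finite.mem_toFinset, Set.mem_setOf_eq, sub_zero]
      have key : ∀ g, |φ (g * x) - φ x| = |φ g| := by
        intro g
        rw [hφ]
        rcases hε x with h | h <;> simp [h]
      constructor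
      · rintro ⟨g, hg, rfl⟩
        rwa [key]
      · intro h
        refine ⟨z * x⁻¹, ?_, by simp⟩
        rw [← key]; simpa using h
    rw [e1]
    constructor
    · intro h
      exact ⟨S.min'_le z h, S.le_max' z h⟩
    · rintro ⟨ha, hb⟩
      have ha' := hlo _ _ ha
      have hb' := hlo _ _ hb
      have h3 := abs_le.1 ((memS _).1 (S.min'_mem hne))
      have h4 := abs_le.1 ((memS _).1 (S.max'_mem hne))
      rw [memS, abs_le]
      constructor <;> linarith

theorem interval_of_normal_cyclic {G : Type*} [Group G] (c : G) (hc : ¬ IsOfFinOrder c)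
    (hN : (Subgroup.zpowers c).Normal) (hfi : (Subgroup.zpowers c).FiniteIndex) :
    ∃ lo : LinearOrder G, IntervalWrt G lo := by
  classical
  set N := Subgroup.zpowers c with hNdef
  have inj : Function.Injective (fun k : ℤ => c ^ k) := injective_zpow_iff_not_isOfFinOrder.2 hc
  have cong : ∀ g : G, ∃ e : ℤ, c ^ e = g * c * g⁻¹ := fun g =>
    Subgroup.mem_zpowers_iff.1 (hN.conj_mem c (Subgroup.mem_zpowers c) g)
  choose ε hε using cong
  have hεk : ∀ g (k : ℤ), g * c ^ k = c ^ (ε g * k) * g := by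
    intro g k
    rw [zpow_mul, hε, conj_zpow]; group
  have hεmul : ∀ g h, ε (g * h) = ε g * ε h := by
    intro g h
    apply inj
    show c ^ _ = c ^ _
    have := hεk g (ε h)
    rw [hε h] at this
    rw [hε, eq_mul_inv_of_mul_eq this.symm]; group
  have hεc : ∀ k : ℤ, ε (c ^ k) = 1 := by
    intro k
    apply inj
    show c ^ _ = c ^ _
    rw [hε]; group
  have hε1 : ε 1 = 1 := by simpa using hεc 0
  have hεu : ∀ g, ε g = 1 ∨ ε g = -1 := by
    intro g
    have : ε g * ε g⁻¹ = 1 := by rw [← hεmul]; simpa using hε1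
    exact Int.eq_one_or_neg_one_of_mul_eq_one this
  have hεsq : ∀ g, ε g * ε g = 1 := by
    intro g; rcases hεu g with h | h <;> simp [h]
  have rex : ∀ g : G, ∃ k : ℤ, c ^ k = g * ((g : G ⧸ N).out)⁻¹ := by
    intro g
    apply Subgroup.mem_zpowers_iff.1
    have h : ((g : G ⧸ N).out : G ⧸ N) = g := Quotient.out_eq' _
    have := QuotientGroup.eq.1 h
    exact hN.mem_comm this
  choose r hr using rex
  have hmk : ∀ (k : ℤ) (g : G), ((c ^ k * g : G) : G ⧸ N) = g := by
    intro k g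
    have : ((c ^ k : G) : G ⧸ N) = 1 :=
      (QuotientGroup.eq_one_iff _).2 (Subgroup.mem_zpowers_iff.2 ⟨k, rfl⟩)
    rw [QuotientGroup.mk_mul, this, one_mul]
  have hrk : ∀ (k : ℤ) (g : G), r (c ^ k * g) = k + r g := by
    intro k g
    apply inj
    show c ^ _ = c ^ _
    rw [hr, hmk, zpow_add, hr, mul_assoc]
  let f : G → G → ℤ := fun h g => ε h * (r (h * g) - r h)
  have hf : ∀ (k : ℤ) h g, f (c ^ k * h) g = f h g := by
    intro k h g
    simp only [f, hεmul, hεc, mul_assoc, hrk]; ring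
  have hfout : ∀ h g : G, f ((h : G ⧸ N).out) g = f h g := by
    intro h g
    have : h = c ^ (r h) * (h : G ⧸ N).out := by rw [hr]; group
    conv_rhs => rw [this]
    rw [hf]
  haveI : Fintype (G ⧸ N) := Fintype.ofFinite _
  let Φ : G → ℤ := fun g => ∑ q : G ⧸ N, f q.out g
  have hΦ : ∀ g x, Φ (g * x) = Φ g + ε g * Φ x := by
    intro g x
    have e2 : Φ x = ∑ q : G ⧸ N, f (q.out * g) x := by
      show ∑ q : G ⧸ N, f q.out x = _
      rw [← Equiv.sum_comp (Equiv.mulRight (g : G ⧸ N))]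
      refine Finset.sum_congr rfl fun q _ => ?_
      rw [← hfout (q.out * g)]
      simp
    rw [e2, Finset.mul_sum, ← Finset.sum_add_distrib]
    refine Finset.sum_congr rfl fun q _ => ?_
    simp only [f, hεmul, mul_assoc]
    linear_combination (-(ε q.out) * (r (q.out * (g * x)) - r (q.out * g))) * hεsq g
  have hΦc : ∀ k : ℤ, Φ (c ^ k) = k * Fintype.card (G ⧸ N) := by
    intro k
    have : ∀ q : G ⧸ N, f q.out (c ^ k) = k := by
      intro q
      simp only [f, hεk, hrk]
      linear_combination k * hεsq q.out
    simp [Φ, this, mul_comm]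
  have hcard : (Fintype.card (G ⧸ N) : ℤ) ≠ 0 := by
    exact_mod_cast Fintype.card_ne_zero
  have hΦfin : ∀ k : ℤ, (Φ ⁻¹' {k}).Finite := by
    intro k
    refine Set.Finite.of_injOn (f := fun g : G => (g : G ⧸ N)) (t := Set.univ)
      (fun _ _ => Set.mem_univ _) ?_ Set.finite_univ
    intro x hx y hy hxy
    have hx : Φ x = k := hx
    have hy : Φ y = k := hy
    obtain ⟨j, hj⟩ := Subgroup.mem_zpowers_iff.1 (hN.mem_comm (QuotientGroup.eq.1 hxy))
    have hyx : y = c ^ j * x := by rw [hj]; group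
    rw [hyx, hΦ, hΦc, hεc, hx] at hy
    have : j = 0 := by
      have : j * (Fintype.card (G ⧸ N) : ℤ) = 0 := by linarith
      exact (mul_eq_zero.1 this).resolve_right hcard
    simp [hyx, this]
  refine interval_of_crossed (fun g => Φ g⁻¹) (fun g => ε g⁻¹) (fun g => hεu _) ?_ ?_
  · intro g x
    simp only [mul_inv_rev, hΦ]
  · intro k
    exact (hΦfin k).preimage (f := fun g : G => g⁻¹) inv_injective.injOn

/-- If `G` contains an infinite cyclic subgroup of finite index, then `G` carries a linear
order for which the finitary coarse structure is interval. -/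
theorem intervalOrder_of_infinite_cyclic_finiteIndex {G : Type*} [Group G]
    (a : G) (ha : ¬ IsOfFinOrder a) (hfi : (Subgroup.zpowers a).FiniteIndex) :
    ∃ lo : LinearOrder G, IntervalWrt G lo := by
  have hle : (Subgroup.zpowers a).normalCore ≤ Subgroup.zpowers a := Subgroup.normalCore_le _
  have hfi' : (Subgroup.zpowers a).normalCore.FiniteIndex := inferInstance
  have hn : (Subgroup.zpowers a).normalCore.Normal := inferInstance
  obtain ⟨c, hc⟩ : ∃ c, (Subgroup.zpowers a).normalCore = Subgroup.zpowers c := by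
    have : IsCyclic (Subgroup.zpowers a).normalCore := Subgroup.isCyclic_of_le hle
    obtain ⟨c, hc⟩ := (Subgroup.isCyclic_iff_exists_zpowers_eq_top _).1 this
    exact ⟨c, hc.symm⟩
  rw [hc] at hfi' hn
  refine interval_of_normal_cyclic c ?_ hn hfi'
  intro h
  apply ha
  have : Finite (Subgroup.zpowers c) := by
    exact h.finite_zpowers
  have : Finite G := Finite.of_equiv _ (Subgroup.groupEquivQuotientProdSubgroup (s := Subgroup.zpowers c)).symm
  exact isOfFinOrder_of_finite a
end

section
/- If a group G is countable and locally finite (every finite subset generates a finite subgroup), then there exists a linear order ≤ on G such that the finitary coarse structure of G is interval with respect to ≤. -/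
open scoped Pointwise

theorem aux_interval (G : Type*) [Group G] (H : ℕ → Subgroup G) (hmono : Monotone H)
    (hfin : ∀ n, (H n : Set G).Finite) (hbot : H 0 = ⊥) (hex : ∀ g, ∃ n, g ∈ H n)
    (e : G → ℕ) (he : Function.Injective e) :
    ∃ lo : LinearOrder G, ∀ (n : ℕ) (x y z : G), y * x⁻¹ ∈ H n → lo.le x z → lo.le z y →
      z * x⁻¹ ∈ H n := by
  classical
  obtain ⟨r, hr⟩ : ∃ r : ℕ → G → ℕ, ∀ n x y, r n x = r n y ↔ y * x⁻¹ ∈ H n := by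
    refine ⟨fun n x => e (Quotient.out (Quotient.mk (QuotientGroup.rightRel (H n)) x)), ?_⟩
    intro n x y
    rw [he.eq_iff, Quotient.out_inj, Quotient.eq, QuotientGroup.rightRel_apply]
  have up : ∀ m n x y, m ≤ n → r m x = r m y → r n x = r n y := by
    intro m n x y h h1
    rw [hr] at *
    exact hmono h h1
  let lt : G → G → Prop := fun x y => ∃ n, r n x < r n y ∧ r (n+1) x = r (n+1) y
  have hirr : ∀ x, ¬ lt x x := by
    rintro x ⟨n, h, -⟩
    exact lt_irrefl _ h
  have htrans : ∀ x y z, lt x y → lt y z → lt x z := by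
    rintro x y z ⟨n, h1, h2⟩ ⟨m, h3, h4⟩
    rcases lt_trichotomy n m with h | h | h
    · have := up _ m _ _ h h2
      have := up _ (m+1) _ _ (by omega : n + 1 ≤ m + 1) h2
      exact ⟨m, by omega, by omega⟩
    · subst h
      exact ⟨n, by omega, by omega⟩
    · have := up _ n _ _ h h4
      have := up _ (n+1) _ _ (by omega : m + 1 ≤ n + 1) h4
      exact ⟨n, by omega, by omega⟩
  have htri : ∀ x y, lt x y ∨ x = y ∨ lt y x := by
    intro x y
    by_cases hxy : x = y
    · exact Or.inr (Or.inl hxy)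
    have hE : ∃ n, r n x = r n y := by
      obtain ⟨n, hn⟩ := hex (y * x⁻¹)
      exact ⟨n, (hr _ _ _).2 hn⟩
    have h0 : r 0 x ≠ r 0 y := by
      intro h
      rw [hr, hbot, Subgroup.mem_bot, mul_inv_eq_one] at h
      exact hxy h.symm
    obtain ⟨k, hk⟩ : ∃ k, Nat.find hE = k + 1 := by
      refine Nat.exists_eq_succ_of_ne_zero ?_
      intro h
      exact h0 (h ▸ Nat.find_spec hE)
    have h1 : r (k+1) x = r (k+1) y := hk ▸ Nat.find_spec hE
    have h2 : r k x ≠ r k y := Nat.find_min hE (by omega)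
    rcases lt_or_gt_of_ne h2 with h | h
    · exact Or.inl ⟨k, h, h1⟩
    · exact Or.inr (Or.inr ⟨k, h, h1.symm⟩)
  let lo : LinearOrder G :=
    { le := fun x y => x = y ∨ lt x y
      lt := lt
      le_refl := fun x => Or.inl rfl
      le_trans := by
        rintro x y z (rfl | h1) (rfl | h2)
        · exact Or.inl rfl
        · exact Or.inr h2
        · exact Or.inr h1
        · exact Or.inr (htrans _ _ _ h1 h2)
      le_antisymm := by
        rintro x y (rfl | h1) (h | h2)
        · rfl
        · rfl
        · exact h.symm
        · exact (hirr _ (htrans _ _ _ h1 h2)).elim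
      le_total := by
        intro x y
        rcases htri x y with h | h | h
        · exact Or.inl (Or.inr h)
        · exact Or.inl (Or.inl h)
        · exact Or.inr (Or.inr h)
      lt_iff_le_not_ge := by
        intro x y
        constructor
        · intro h
          refine ⟨Or.inr h, ?_⟩
          rintro (rfl | h2)
          · exact hirr _ h
          · exact hirr _ (htrans _ _ _ h h2)
        · rintro ⟨rfl | h, h2⟩
          · exact (h2 (Or.inl rfl)).elim
          · exact h
      toDecidableLE := Classical.decRel _ }
  refine ⟨lo, ?_⟩
  intro n x y z hxy hxz hzy
  rw [← hr] at hxy ⊢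
  by_contra hne
  rcases hxz with rfl | ⟨k, h1, h2⟩
  · exact hne rfl
  have hkn : n ≤ k := by
    by_contra h
    exact hne (up _ n _ _ (by omega) h2)
  have a1 := up _ k _ _ hkn hxy
  have a2 := up _ (k+1) _ _ (by omega : n ≤ k + 1) hxy
  have hyz : lt y z := ⟨k, by omega, by omega⟩
  rcases hzy with rfl | h
  · exact hirr _ hyz
  · exact hirr _ (htrans _ _ _ hyz h)

/-- If `G` is countable and locally finite, then `G` carries a linear order for which
the finitary coarse structure is interval. -/
theorem intervalOrder_of_countable_locallyFinite (G : Type*) [Group G] [Countable G]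
    (hlf : ∀ S : Finset G, ((Subgroup.closure (S : Set G) : Subgroup G) : Set G).Finite) :
    ∃ lo : LinearOrder G, IntervalWrt G lo := by
  classical
  obtain ⟨e, he⟩ := exists_injective_nat G
  have hf : ∀ n, {g : G | e g < n}.Finite := fun n =>
    (Set.finite_lt_nat n).preimage he.injOn
  let H : ℕ → Subgroup G := fun n => Subgroup.closure {g : G | e g < n}
  have hmono : Monotone H := fun m n h =>
    Subgroup.closure_mono fun g (hg : e g < m) => lt_of_lt_of_le hg h
  have hfin : ∀ n, (H n : Set G).Finite := by
    intro n
    have := hlf (hf n).toFinset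
    rwa [Set.Finite.coe_toFinset] at this
  have hbot : H 0 = ⊥ := by simp [H]
  have hmem : ∀ g n, e g < n → g ∈ H n := fun g n h => Subgroup.subset_closure h
  obtain ⟨lo, hlo⟩ := aux_interval G H hmono hfin hbot (fun g => ⟨e g + 1, hmem _ _ (by omega)⟩) e he
  refine ⟨lo, ?_⟩
  intro F hF
  let n := F.sup e + 1
  have hFn : ∀ g ∈ F, g ∈ H n := fun g hg =>
    hmem _ _ (Nat.lt_succ_of_le (Finset.le_sup (f := e) hg))
  refine ⟨(hfin n).toFinset, ?_, ?_, ?_⟩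
  · intro g hg
    simpa using hFn g hg
  · simpa using (H n).one_mem
  intro x
  rw [Set.Finite.coe_toFinset]
  have key : ∀ z, z ∈ ((H n : Set G) * {x} : Set G) ↔ z * x⁻¹ ∈ H n := by
    intro z
    rw [Set.mul_singleton]
    constructor
    · rintro ⟨h, hh, rfl⟩
      simpa using hh
    · intro h
      exact ⟨_, h, by simp⟩
  have hS : ((H n : Set G) * {x} : Set G).Finite := (hfin n).mul (Set.finite_singleton x)
  have hx : x ∈ ((H n : Set G) * {x} : Set G) := by
    rw [key]; simp
  letI := lo
  obtain ⟨a, ha, ha'⟩ := Set.exists_min_image _ (fun z : G => z) hS ⟨x, hx⟩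
  obtain ⟨b, hb, hb'⟩ := Set.exists_max_image _ (fun z : G => z) hS ⟨x, hx⟩
  refine ⟨a, b, ha' x hx, hb' x hx, ?_⟩
  ext z
  constructor
  · intro hz
    exact ⟨ha' z hz, hb' z hz⟩
  · rintro ⟨h1, h2⟩
    rw [key] at ha hb ⊢
    have h3 : b * a⁻¹ ∈ H n := by
      simpa using (H n).mul_mem hb ((H n).inv_mem ha)
    simpa using (H n).mul_mem (hlo n a b z h3 h1 h2) ha
end

section
/- The group ℤ does not admit a global selector: there is no map f from the nonempty subsets of ℤ to ℤ such that f(A) ∈ A for every nonempty A ⊆ ℤ and f is macro-uniform, i.e. for every n ∈ ℕ there exists m ∈ ℕ such that for all nonempty X,Y ⊆ ℤ with X ⊆ Y + [−n,n] and Y ⊆ X + [−n,n], one has |f(X) − f(Y)| ≤ m. -/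
/-- The group `ℤ` admits no global selector: no map `f` from the nonempty subsets of `ℤ`
to `ℤ` with `f A ∈ A` for every nonempty `A` is macro-uniform for the finitary coarse
structure of `ℤ`. -/
theorem int_no_global_selector : ¬ ∃ f : Set ℤ → ℤ,
    (∀ A : Set ℤ, A.Nonempty → f A ∈ A) ∧
    (∀ n : ℕ, ∃ m : ℕ, ∀ X Y : Set ℤ, X.Nonempty → Y.Nonempty →
      (∀ x ∈ X, ∃ y ∈ Y, |x - y| ≤ (n : ℤ)) → (∀ y ∈ Y, ∃ x ∈ X, |x - y| ≤ (n : ℤ)) →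
      |f X - f Y| ≤ (m : ℤ)) := by
  rintro ⟨f, hf, hu⟩
  obtain ⟨m, hm⟩ := hu 1
  let S : ℤ → Set ℤ := fun t => {z | ((m : ℤ) + 2) ∣ z - t}
  have hne : ∀ t, (S t).Nonempty := fun t => ⟨t, by simp [S]⟩
  have hstep : ∀ t, f (S (t + 1)) = f (S t) + 1 := by
    intro t
    have h1 : ((m : ℤ) + 2) ∣ f (S t) - t := hf _ (hne t)
    have h2 : ((m : ℤ) + 2) ∣ f (S (t + 1)) - (t + 1) := hf _ (hne (t + 1))
    have h3 : |f (S t) - f (S (t + 1))| ≤ (m : ℤ) := by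
      refine hm _ _ (hne _) (hne _) ?_ ?_
      · intro x hx
        refine ⟨x + 1, ?_, by simp⟩
        have hx' : ((m : ℤ) + 2) ∣ x - t := hx
        have : ((m : ℤ) + 2) ∣ (x + 1) - (t + 1) := by
          rwa [show (x + 1) - (t + 1) = x - t by ring]
        exact this
      · intro x hx
        refine ⟨x - 1, ?_, by simp⟩
        have hx' : ((m : ℤ) + 2) ∣ x - (t + 1) := hx
        have : ((m : ℤ) + 2) ∣ (x - 1) - t := by
          rwa [show (x - 1) - t = x - (t + 1) by ring]
        exact this
    have h4 : ((m : ℤ) + 2) ∣ f (S (t + 1)) - (f (S t) + 1) := by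
      have := dvd_sub h2 h1
      rwa [show f (S (t + 1)) - (t + 1) - (f (S t) - t) = f (S (t + 1)) - (f (S t) + 1) by ring] at this
    rw [abs_le] at h3
    have h5 := Int.eq_zero_of_abs_lt_dvd h4 (by rw [abs_lt]; constructor <;> linarith)
    linarith
  have hall : ∀ k : ℕ, f (S k) = f (S 0) + k := by
    intro k
    induction k with
    | zero => simp
    | succ k ih => push_cast; rw [hstep, ih]; ring
  have hper : S ((m + 2 : ℕ) : ℤ) = S 0 := by
    ext z
    simp only [S, Set.mem_ofPred_eq, sub_zero]
    push_cast
    exact dvd_sub_self_right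
  have h := hall (m + 2)
  rw [hper] at h
  push_cast at h
  linarith
end
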